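/- Consider the difference equation u_{n+1} = A_nu_n with invertible, uniformly bounded A_n ∈ ℝ^{d×d} whose inverses are uniformly bounded, and the kinematically transformed system with matrices Ã_n = Q_{n+1}A_nQ_n⁻¹ where Q_n ∈ GL(ℝ^d) satisfy lim_{n→∞} Q_n = Q with Q invertible. Then for every 1 ≤ s ≤ d and each of the four types of angular values, the angular value of the system (A_n) vanishes if and only if the corresponding angular value of the system (Ã_n) vanishes. -/

import Mathlib

open scoped Matrix RealInnerProductSpace
open Module Filter

noncomputable def maxAngle {d : ℕ} (V W : Submodule ℝ (EuclideanSpace ℝ (Fin d))) : ℝ :=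
  Real.arccos (sInf {r : ℝ | ∃ v ∈ V, ‖v‖ = 1 ∧
    r = sSup {c : ℝ | ∃ w ∈ W, ‖w‖ = 1 ∧ c = ⟪v, w⟫}})

/-- The spectral norm of a real matrix. -/
noncomputable def sNorm {m n : ℕ} (A : Matrix (Fin m) (Fin n) ℝ) : ℝ :=
  ‖LinearMap.toContinuousLinearMap (Matrix.toEuclideanLin A)‖

/-- The image `SV = {Sv : v ∈ V}` of a subspace under a matrix. -/
noncomputable def mapMat {d : ℕ} (S : Matrix (Fin d) (Fin d) ℝ)
    (V : Submodule ℝ (EuclideanSpace ℝ (Fin d))) : Submodule ℝ (EuclideanSpace ℝ (Fin d)) :=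
  V.map (Matrix.toEuclideanLin S)

/-- The solution operator `Φ(n,0) = A_{n−1} ⋯ A_0` of `u_{n+1} = A_n u_n`. -/
def PhiD {d : ℕ} (A : ℕ → Matrix (Fin d) (Fin d) ℝ) : ℕ → Matrix (Fin d) (Fin d) ℝ
  | 0 => 1
  | n + 1 => A n * PhiD A n

/-- `a_{1,n}(V) = Σ_{j=1}^n ∠(Φ(j−1,0)V, Φ(j,0)V)`. -/
noncomputable def aDisc {d : ℕ} (A : ℕ → Matrix (Fin d) (Fin d) ℝ)
    (V : Submodule ℝ (EuclideanSpace ℝ (Fin d))) (n : ℕ) : ℝ :=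
  ∑ j ∈ Finset.range n, maxAngle (mapMat (PhiD A j) V) (mapMat (PhiD A (j + 1)) V)

/-- The outer angular value `θ_s^{sup,limsup}`. -/
noncomputable def thSupLimsup {d : ℕ} (s : ℕ) (A : ℕ → Matrix (Fin d) (Fin d) ℝ) : ℝ :=
  ⨆ V : {V : Submodule ℝ (EuclideanSpace ℝ (Fin d)) // finrank ℝ V = s},
    limsup (fun n : ℕ => aDisc A V.1 n / n) atTop

/-- The outer angular value `θ_s^{sup,liminf}`. -/
noncomputable def thSupLiminf {d : ℕ} (s : ℕ) (A : ℕ → Matrix (Fin d) (Fin d) ℝ) : ℝ :=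
  ⨆ V : {V : Submodule ℝ (EuclideanSpace ℝ (Fin d)) // finrank ℝ V = s},
    liminf (fun n : ℕ => aDisc A V.1 n / n) atTop

/-- The inner angular value `θ_s^{limsup,sup}`. -/
noncomputable def thLimsupSup {d : ℕ} (s : ℕ) (A : ℕ → Matrix (Fin d) (Fin d) ℝ) : ℝ :=
  limsup (fun n : ℕ =>
    ⨆ V : {V : Submodule ℝ (EuclideanSpace ℝ (Fin d)) // finrank ℝ V = s},
      aDisc A V.1 n / n) atTop

/-- The inner angular value `θ_s^{liminf,sup}`. -/
noncomputable def thLiminfSup {d : ℕ} (s : ℕ) (A : ℕ → Matrix (Fin d) (Fin d) ℝ) : ℝ :=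
  liminf (fun n : ℕ =>
    ⨆ V : {V : Submodule ℝ (EuclideanSpace ℝ (Fin d)) // finrank ℝ V = s},
      aDisc A V.1 n / n) atTop

/-- inner sup -/
noncomputable def innS {d : ℕ} (W : Submodule ℝ (EuclideanSpace ℝ (Fin d)))
    (v : EuclideanSpace ℝ (Fin d)) : ℝ :=
  sSup {c : ℝ | ∃ w ∈ W, ‖w‖ = 1 ∧ c = ⟪v, w⟫}

theorem innS_le_of {d : ℕ} (W : Submodule ℝ (EuclideanSpace ℝ (Fin d)))
    (v : EuclideanSpace ℝ (Fin d)) : innS W v ≤ ‖W.starProjection v‖ := by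
  apply Real.sSup_le _ (norm_nonneg _)
  rintro c ⟨w, hw, h1, rfl⟩
  have : ⟪v, w⟫ = ⟪W.starProjection v, w⟫ := by
    have h := Submodule.starProjection_inner_eq_zero (K := W) v w hw
    rw [inner_sub_left] at h
    linarith
  rw [this]
  calc _ ≤ ‖W.starProjection v‖ * ‖w‖ := real_inner_le_norm _ _
    _ = _ := by rw [h1, mul_one]

theorem exists_unit {d : ℕ} {W : Submodule ℝ (EuclideanSpace ℝ (Fin d))} (hW : W ≠ ⊥) :
    ∃ w ∈ W, ‖w‖ = 1 := by
  obtain ⟨x, hx, h0⟩ := Submodule.exists_mem_ne_zero_of_ne_bot hW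
  exact ⟨‖x‖⁻¹ • x, W.smul_mem _ hx, norm_smul_inv_norm h0⟩

theorem innS_bdd {d : ℕ} (W : Submodule ℝ (EuclideanSpace ℝ (Fin d)))
    (v : EuclideanSpace ℝ (Fin d)) :
    BddAbove {c : ℝ | ∃ w ∈ W, ‖w‖ = 1 ∧ c = ⟪v, w⟫} := by
  refine ⟨‖v‖, ?_⟩
  rintro c ⟨w, hw, h1, rfl⟩
  calc _ ≤ ‖v‖ * ‖w‖ := real_inner_le_norm _ _
    _ = _ := by rw [h1, mul_one]

theorem innS_nonneg {d : ℕ} {W : Submodule ℝ (EuclideanSpace ℝ (Fin d))}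
    (v : EuclideanSpace ℝ (Fin d)) : 0 ≤ innS W v := by
  by_cases hW : W = ⊥
  · have : {c : ℝ | ∃ w ∈ W, ‖w‖ = 1 ∧ c = ⟪v, w⟫} = ∅ := by
      ext c
      simp only [Set.mem_setOf_eq, Set.mem_empty_iff_false, iff_false]
      rintro ⟨w, hw, h1, -⟩
      rw [hW, Submodule.mem_bot] at hw
      simp [hw] at h1
    rw [innS, this, Real.sSup_empty]
  obtain ⟨w, hw, h1⟩ := exists_unit hW
  have a : ⟪v, w⟫ ≤ innS W v := le_csSup (innS_bdd W v) ⟨w, hw, h1, rfl⟩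
  have b : ⟪v, -w⟫ ≤ innS W v := le_csSup (innS_bdd W v) ⟨-w, W.neg_mem hw, by simpa, rfl⟩
  rw [inner_neg_right] at b
  linarith

theorem le_innS {d : ℕ} (W : Submodule ℝ (EuclideanSpace ℝ (Fin d)))
    (v : EuclideanSpace ℝ (Fin d)) : ‖W.starProjection v‖ ≤ innS W v := by
  by_cases h0 : W.starProjection v = 0
  · rw [h0, norm_zero]; exact innS_nonneg v
  have hm : W.starProjection v ∈ W := Submodule.starProjection_apply_mem W v
  refine le_csSup (innS_bdd W v) ⟨‖W.starProjection v‖⁻¹ • W.starProjection v,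
    W.smul_mem _ hm, norm_smul_inv_norm h0, ?_⟩
  have h := Submodule.starProjection_inner_eq_zero (K := W) v _ hm
  rw [inner_sub_left, real_inner_self_eq_norm_sq] at h
  have h' : ⟪v, W.starProjection v⟫ = ‖W.starProjection v‖ ^ 2 := by linarith
  have : ‖W.starProjection v‖ ≠ 0 := norm_ne_zero_iff.2 h0
  rw [inner_smul_right, h']
  field_simp

theorem innS_eq {d : ℕ} (W : Submodule ℝ (EuclideanSpace ℝ (Fin d)))
    (v : EuclideanSpace ℝ (Fin d)) : innS W v = ‖W.starProjection v‖ :=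
  le_antisymm (innS_le_of W v) (le_innS W v)

theorem norm_sub_sq_proj {d : ℕ} (W : Submodule ℝ (EuclideanSpace ℝ (Fin d)))
    (v : EuclideanSpace ℝ (Fin d)) :
    ‖v - W.starProjection v‖ ^ 2 = ‖v‖ ^ 2 - ‖W.starProjection v‖ ^ 2 := by
  have hm : W.starProjection v ∈ W := Submodule.starProjection_apply_mem W v
  have h := Submodule.starProjection_inner_eq_zero (K := W) v _ hm
  rw [inner_sub_left, real_inner_self_eq_norm_sq] at h
  rw [norm_sub_sq_real]
  linarith

/-- cosine of the maximal angle -/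
noncomputable def cosA {d : ℕ} (V W : Submodule ℝ (EuclideanSpace ℝ (Fin d))) : ℝ :=
  sInf {r : ℝ | ∃ v ∈ V, ‖v‖ = 1 ∧ r = innS W v}

theorem maxAngle_eq {d : ℕ} (V W : Submodule ℝ (EuclideanSpace ℝ (Fin d))) :
    maxAngle V W = Real.arccos (cosA V W) := rfl

theorem cosA_nonneg {d : ℕ} (V W : Submodule ℝ (EuclideanSpace ℝ (Fin d))) : 0 ≤ cosA V W := by
  apply Real.sInf_nonneg
  rintro r ⟨v, -, -, rfl⟩
  exact innS_nonneg v

theorem cosA_le {d : ℕ} {V W : Submodule ℝ (EuclideanSpace ℝ (Fin d))}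
    {v : EuclideanSpace ℝ (Fin d)} (hv : v ∈ V) (h1 : ‖v‖ = 1) :
    cosA V W ≤ ‖W.starProjection v‖ := by
  rw [← innS_eq]
  refine csInf_le ⟨0, ?_⟩ ⟨v, hv, h1, rfl⟩
  rintro r ⟨v, -, -, rfl⟩
  exact innS_nonneg v

theorem maxAngle_nonneg {d : ℕ} (V W : Submodule ℝ (EuclideanSpace ℝ (Fin d))) :
    0 ≤ maxAngle V W := Real.arccos_nonneg _

theorem maxAngle_le_pi {d : ℕ} (V W : Submodule ℝ (EuclideanSpace ℝ (Fin d))) :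
    maxAngle V W ≤ Real.pi := Real.arccos_le_pi _

theorem gap_of_angle {d : ℕ} (V W : Submodule ℝ (EuclideanSpace ℝ (Fin d)))
    {x : EuclideanSpace ℝ (Fin d)} (hx : x ∈ V) :
    ∃ y ∈ W, ‖x - y‖ ≤ maxAngle V W * ‖x‖ := by
  by_cases h0 : x = 0
  · exact ⟨0, W.zero_mem, by simp [h0]⟩
  have hn : 0 < ‖x‖ := norm_pos_iff.2 h0
  set v := ‖x‖⁻¹ • x with hv
  have hv1 : ‖v‖ = 1 := norm_smul_inv_norm h0
  have hvV : v ∈ V := V.smul_mem _ hx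
  have hxv : x = ‖x‖ • v := by rw [hv, smul_smul, mul_inv_cancel₀ hn.ne', one_smul]
  refine ⟨‖x‖ • W.starProjection v, W.smul_mem _ (Submodule.starProjection_apply_mem W v), ?_⟩
  have e : x - ‖x‖ • W.starProjection v = ‖x‖ • (v - W.starProjection v) := by
    rw [smul_sub, ← hxv]
  rw [e, norm_smul, norm_norm, mul_comm]
  apply mul_le_mul_of_nonneg_right _ hn.le
  have hc := cosA_le (W := W) hvV hv1
  have hc0 := cosA_nonneg V W
  have hs := norm_sub_sq_proj W v
  rw [hv1] at hs
  calc ‖v - W.starProjection v‖ ≤ √(1 - cosA V W ^ 2) := by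
        apply Real.le_sqrt_of_sq_le
        nlinarith
    _ = Real.sin (maxAngle V W) := by rw [maxAngle_eq, Real.sin_arccos]
    _ ≤ maxAngle V W := Real.sin_le (maxAngle_nonneg V W)

theorem angle_of_gap {d : ℕ} {V W : Submodule ℝ (EuclideanSpace ℝ (Fin d))} (hV : V ≠ ⊥)
    {δ : ℝ} (hδ : 0 ≤ δ)
    (h : ∀ v ∈ V, ‖v‖ = 1 → ∃ w ∈ W, ‖v - w‖ ≤ δ) :
    maxAngle V W ≤ Real.pi / 2 * δ := by
  have hK : √(1 - δ ^ 2) ≤ cosA V W := by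
    obtain ⟨v0, hv0, h01⟩ := exists_unit hV
    refine le_csInf (s := {r : ℝ | ∃ v ∈ V, ‖v‖ = 1 ∧ r = innS W v}) ⟨_, v0, hv0, h01, rfl⟩ ?_
    rintro r ⟨v, hv, h1, rfl⟩
    obtain ⟨w, hw, hd⟩ := h v hv h1
    rw [innS_eq]
    apply Real.sqrt_le_iff.2 ⟨norm_nonneg _, ?_⟩
    have hs := norm_sub_sq_proj W v
    rw [h1] at hs
    have hmin : ‖v - W.starProjection v‖ ≤ ‖v - w‖ := by
      rw [Submodule.starProjection_minimal]
      exact ciInf_le ⟨0, by rintro _ ⟨y, rfl⟩; exact norm_nonneg _⟩ (⟨w, hw⟩ : W)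
    have := pow_le_pow_left₀ (norm_nonneg _) (hmin.trans hd) 2
    linarith
  have hc0 := cosA_nonneg V W
  have hs : Real.sin (maxAngle V W) ≤ δ := by
    rw [maxAngle_eq, Real.sin_arccos]
    apply Real.sqrt_le_iff.2 ⟨hδ, ?_⟩
    have := (Real.sqrt_le_iff.1 hK).2
    linarith
  have h2 : maxAngle V W ≤ Real.pi / 2 := Real.arccos_le_pi_div_two.2 hc0
  have := Real.mul_le_sin (maxAngle_nonneg V W) h2
  have hp := Real.pi_pos
  have h3 : 2 / Real.pi * maxAngle V W ≤ δ := this.trans hs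
  calc maxAngle V W = Real.pi / 2 * (2 / Real.pi * maxAngle V W) := by field_simp
    _ ≤ _ := by gcongr

theorem sNorm_mulVec {d : ℕ} (S : Matrix (Fin d) (Fin d) ℝ) (x : EuclideanSpace ℝ (Fin d)) :
    ‖Matrix.toEuclideanLin S x‖ ≤ sNorm S * ‖x‖ :=
  (LinearMap.toContinuousLinearMap (Matrix.toEuclideanLin S)).le_opNorm x

theorem toE_mul {d : ℕ} (S T : Matrix (Fin d) (Fin d) ℝ) (x : EuclideanSpace ℝ (Fin d)) :
    Matrix.toEuclideanLin (S * T) x = Matrix.toEuclideanLin S (Matrix.toEuclideanLin T x) := by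
  simp [Matrix.toLpLin_apply, Matrix.mulVec_mulVec]

theorem mapMat_mul {d : ℕ} (S T : Matrix (Fin d) (Fin d) ℝ)
    (V : Submodule ℝ (EuclideanSpace ℝ (Fin d))) :
    mapMat (S * T) V = mapMat S (mapMat T V) := by
  ext x
  simp only [mapMat, Submodule.mem_map, exists_exists_and_eq_and, toE_mul]

theorem mapMat_one {d : ℕ} (V : Submodule ℝ (EuclideanSpace ℝ (Fin d))) :
    mapMat 1 V = V := by
  ext x
  simp [mapMat, Submodule.mem_map]

theorem toE_inv_apply {d : ℕ} {S : Matrix (Fin d) (Fin d) ℝ} (hS : IsUnit S)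
    (x : EuclideanSpace ℝ (Fin d)) :
    Matrix.toEuclideanLin S⁻¹ (Matrix.toEuclideanLin S x) = x := by
  rw [← toE_mul, Matrix.nonsing_inv_mul _ ((Matrix.isUnit_iff_isUnit_det _).1 hS)]
  simp

theorem finrank_mapMat {d : ℕ} {S : Matrix (Fin d) (Fin d) ℝ} (hS : IsUnit S)
    (V : Submodule ℝ (EuclideanSpace ℝ (Fin d))) :
    finrank ℝ (mapMat S V) = finrank ℝ V := by
  have hi : Function.Injective (Matrix.toEuclideanLin S) :=
    Function.LeftInverse.injective (toE_inv_apply hS)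
  exact (Submodule.equivMapOfInjective _ hi V).finrank_eq.symm

theorem angle_step {d : ℕ} {P R : Matrix (Fin d) (Fin d) ℝ} (hP : IsUnit P) {M : ℝ}
    (hPi : sNorm P⁻¹ ≤ M) (hR : sNorm R ≤ M)
    {X Y : Submodule ℝ (EuclideanSpace ℝ (Fin d))} (hX : mapMat P X ≠ ⊥) :
    maxAngle (mapMat P X) (mapMat R Y) ≤
      Real.pi / 2 * (M * M * maxAngle X Y + M * sNorm (P - R)) := by
  have hM : 0 ≤ M := le_trans (norm_nonneg _) hR
  have hA := maxAngle_nonneg X Y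
  have hN : 0 ≤ sNorm (P - R) := norm_nonneg _
  apply angle_of_gap hX (by positivity)
  rintro v ⟨x, hx, rfl⟩ h1
  obtain ⟨y, hy, hxy⟩ := gap_of_angle X Y hx
  refine ⟨_, ⟨y, hy, rfl⟩, ?_⟩
  have hxM : ‖x‖ ≤ M := by
    have := sNorm_mulVec P⁻¹ (Matrix.toEuclideanLin P x)
    rw [toE_inv_apply hP, h1] at this
    linarith
  have e : Matrix.toEuclideanLin P x - Matrix.toEuclideanLin R y =
      Matrix.toEuclideanLin R (x - y) + Matrix.toEuclideanLin (P - R) x := by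
    simp only [map_sub, LinearMap.sub_apply]; abel
  rw [e]
  calc _ ≤ sNorm R * ‖x - y‖ + sNorm (P - R) * ‖x‖ :=
        (norm_add_le _ _).trans (add_le_add (sNorm_mulVec _ _) (sNorm_mulVec _ _))
    _ ≤ M * (maxAngle X Y * M) + sNorm (P - R) * M := by
        gcongr
        exact hxy.trans (by gcongr)
    _ = _ := by ring

theorem aDisc_nonneg {d : ℕ} (A : ℕ → Matrix (Fin d) (Fin d) ℝ)
    (V : Submodule ℝ (EuclideanSpace ℝ (Fin d))) (n : ℕ) : 0 ≤ aDisc A V n / n :=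
  div_nonneg (Finset.sum_nonneg fun _ _ => maxAngle_nonneg _ _) (Nat.cast_nonneg n)

theorem aDisc_le {d : ℕ} (A : ℕ → Matrix (Fin d) (Fin d) ℝ)
    (V : Submodule ℝ (EuclideanSpace ℝ (Fin d))) (n : ℕ) : aDisc A V n / n ≤ Real.pi := by
  apply div_le_of_le_mul₀ (Nat.cast_nonneg n) Real.pi_pos.le
  calc aDisc A V n ≤ ∑ j ∈ Finset.range n, Real.pi :=
        Finset.sum_le_sum fun _ _ => maxAngle_le_pi _ _
    _ = _ := by simp [mul_comm]

theorem phi_unit {d : ℕ} {A : ℕ → Matrix (Fin d) (Fin d) ℝ} (hinv : ∀ n, IsUnit (A n)) (n : ℕ) :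
    IsUnit (PhiD A n) := by
  induction n with
  | zero => exact isUnit_one
  | succ n ih => exact (hinv n).mul ih

theorem phi_tr {d : ℕ} {A At P : ℕ → Matrix (Fin d) (Fin d) ℝ} (hP : ∀ n, IsUnit (P n))
    (hAt : ∀ n, At n = P (n + 1) * A n * (P n)⁻¹) (n : ℕ) :
    PhiD At n = P n * PhiD A n * (P 0)⁻¹ := by
  have hd : ∀ n, IsUnit (P n).det := fun n => (Matrix.isUnit_iff_isUnit_det _).1 (hP n)
  induction n with
  | zero => simp [PhiD, Matrix.mul_nonsing_inv _ (hd 0)]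
  | succ n ih =>
    rw [PhiD, ih, hAt, PhiD]
    simp only [Matrix.mul_assoc]
    rw [Matrix.nonsing_inv_mul_cancel_left _ _ (hd n)]

/-- Main comparison estimate. -/
theorem compare {d s : ℕ} (hs : 1 ≤ s) {A At P : ℕ → Matrix (Fin d) (Fin d) ℝ}
    (hinv : ∀ n, IsUnit (A n)) (hP : ∀ n, IsUnit (P n)) {M : ℝ}
    (hM : ∀ n, sNorm (P n) ≤ M) (hMi : ∀ n, sNorm (P n)⁻¹ ≤ M)
    (hlim : Tendsto (fun n => sNorm (P n - P (n + 1))) atTop (nhds 0))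
    (hAt : ∀ n, At n = P (n + 1) * A n * (P n)⁻¹) :
    ∃ (C : ℝ) (e : ℕ → ℝ), 0 ≤ C ∧ (∀ n, 0 ≤ e n) ∧ Tendsto e atTop (nhds 0) ∧
      ∀ V : {V : Submodule ℝ (EuclideanSpace ℝ (Fin d)) // finrank ℝ V = s},
      ∃ U : {V : Submodule ℝ (EuclideanSpace ℝ (Fin d)) // finrank ℝ V = s},
      ∀ n : ℕ, aDisc At V.1 n / n ≤ C * (aDisc A U.1 n / n) + e n := by
  have hM0 : 0 ≤ M := le_trans (norm_nonneg _) (hM 0)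
  have hp := Real.pi_pos
  refine ⟨Real.pi / 2 * (M * M), fun n => Real.pi / 2 * M *
    ((n : ℝ)⁻¹ * ∑ j ∈ Finset.range n, sNorm (P j - P (j + 1))), by positivity, ?_, ?_, ?_⟩
  · intro n
    have : 0 ≤ ∑ j ∈ Finset.range n, sNorm (P j - P (j + 1)) :=
      Finset.sum_nonneg fun _ _ => norm_nonneg _
    positivity
  · simpa using (hlim.cesaro).const_mul (Real.pi / 2 * M)
  · rintro ⟨V, hV⟩
    have hu : IsUnit (P 0)⁻¹ := Matrix.isUnit_nonsing_inv_iff.2 (hP 0)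
    refine ⟨⟨mapMat (P 0)⁻¹ V, by rw [finrank_mapMat hu, hV]⟩, fun n => ?_⟩
    have key : aDisc At V n ≤ Real.pi / 2 * (M * M) * aDisc A (mapMat (P 0)⁻¹ V) n +
        Real.pi / 2 * M * ∑ j ∈ Finset.range n, sNorm (P j - P (j + 1)) := by
      rw [aDisc, aDisc, Finset.mul_sum, Finset.mul_sum, ← Finset.sum_add_distrib]
      apply Finset.sum_le_sum
      intro j _
      rw [phi_tr hP hAt, phi_tr hP hAt, Matrix.mul_assoc, Matrix.mul_assoc,
        mapMat_mul (P j), mapMat_mul (P (j + 1)), mapMat_mul (PhiD A j),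
        mapMat_mul (PhiD A (j + 1))]
      refine (angle_step (hP j) (hMi j) (hM (j + 1)) ?_).trans (le_of_eq (by ring))
      intro hb
      have := finrank_mapMat (hP j) (mapMat (PhiD A j) (mapMat (P 0)⁻¹ V))
      rw [hb, finrank_mapMat (phi_unit hinv j), finrank_mapMat hu, hV, finrank_bot] at this
      omega
    calc aDisc At V n / n ≤ _ := div_le_div_of_nonneg_right key (Nat.cast_nonneg n)
      _ = _ := by dsimp only; ring

/-- Abstract implication. -/
theorem bddS {u : ℕ → ℝ} {b : ℝ} (h0 : ∀ n, 0 ≤ u n) (hb : ∀ n, u n ≤ b) :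
    IsBoundedUnder (· ≤ ·) atTop u ∧ IsBoundedUnder (· ≥ ·) atTop u :=
  ⟨isBoundedUnder_of ⟨b, hb⟩, isBoundedUnder_of ⟨0, h0⟩⟩

theorem limsup_nonneg' {u : ℕ → ℝ} {b : ℝ} (h0 : ∀ n, 0 ≤ u n) (hb : ∀ n, u n ≤ b) :
    0 ≤ limsup u atTop ∧ 0 ≤ liminf u atTop ∧ limsup u atTop ≤ b ∧ liminf u atTop ≤ b := by
  obtain ⟨h1, h2⟩ := bddS h0 hb
  have a : 0 ≤ liminf u atTop := le_liminf_of_le h1.isCoboundedUnder_ge (Eventually.of_forall h0)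
  have c : limsup u atTop ≤ b := limsup_le_of_le h2.isCoboundedUnder_le (Eventually.of_forall hb)
  have m := liminf_le_limsup h1 h2
  exact ⟨a.trans m, a, c, m.trans c⟩

theorem lims_zero {u v e : ℕ → ℝ} {b C : ℝ} (hC : 0 ≤ C) (he : Tendsto e atTop (nhds 0))
    (hu0 : ∀ n, 0 ≤ u n) (hub : ∀ n, u n ≤ b) (hv0 : ∀ n, 0 ≤ v n) (hvb : ∀ n, v n ≤ b)
    (h : ∀ n, v n ≤ C * u n + e n) :
    (limsup u atTop = 0 → limsup v atTop = 0) ∧ (liminf u atTop = 0 → liminf v atTop = 0) := by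
  obtain ⟨u1, u2⟩ := bddS hu0 hub
  obtain ⟨v1, v2⟩ := bddS hv0 hvb
  obtain ⟨k1, k2, -, -⟩ := limsup_nonneg' hv0 hvb
  constructor
  · intro hz
    refine le_antisymm (le_of_forall_pos_le_add fun ε hε => ?_) k1
    have hε' : 0 < ε / (2 * (C + 1)) := by positivity
    have e1 : ∀ᶠ n in atTop, u n < ε / (2 * (C + 1)) :=
      eventually_lt_of_limsup_lt (by rw [hz]; exact hε') u1
    have e2 : ∀ᶠ n in atTop, e n < ε / 2 := he.eventually (gt_mem_nhds (by positivity))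
    apply limsup_le_of_le v2.isCoboundedUnder_le
    filter_upwards [e1, e2] with n a1 a2
    have : (C + 1) * (ε / (2 * (C + 1))) = ε / 2 := by field_simp
    have := h n
    nlinarith [hu0 n]
  · intro hz
    refine le_antisymm (le_of_forall_pos_le_add fun ε hε => ?_) k2
    have hε' : 0 < ε / (2 * (C + 1)) := by positivity
    have e1 : ∃ᶠ n in atTop, u n < ε / (2 * (C + 1)) :=
      frequently_lt_of_liminf_lt u1.isCoboundedUnder_ge (by rw [hz]; exact hε')
    have e2 : ∀ᶠ n in atTop, e n < ε / 2 := he.eventually (gt_mem_nhds (by positivity))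
    apply liminf_le_of_frequently_le _ v2
    refine (e1.and_eventually e2).mono ?_
    rintro n ⟨a1, a2⟩
    have : (C + 1) * (ε / (2 * (C + 1))) = ε / 2 := by field_simp
    have := h n
    nlinarith [hu0 n]

theorem sup_zero {ι : Type*} {f : ι → ℝ} {b : ℝ} (h0 : ∀ i, 0 ≤ f i) (hb : ∀ i, f i ≤ b) :
    (⨆ i, f i) = 0 ↔ ∀ i, f i = 0 := by
  constructor
  · intro h i
    exact le_antisymm (h ▸ le_ciSup ⟨b, by rintro _ ⟨j, rfl⟩; exact hb j⟩ i) (h0 i)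
  · intro h
    simp [h]

theorem four {ι : Type*} {f g : ι → ℕ → ℝ} {e : ℕ → ℝ} {b C : ℝ} (hC : 0 ≤ C) (hb : 0 ≤ b)
    (he0 : ∀ n, 0 ≤ e n)
    (he : Tendsto e atTop (nhds 0))
    (hf0 : ∀ i n, 0 ≤ f i n) (hfb : ∀ i n, f i n ≤ b)
    (hg0 : ∀ i n, 0 ≤ g i n) (hgb : ∀ i n, g i n ≤ b)
    (h : ∀ i, ∃ k, ∀ n, g i n ≤ C * f k n + e n) :
    ((⨆ i, limsup (f i) atTop) = 0 → (⨆ i, limsup (g i) atTop) = 0) ∧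
    ((⨆ i, liminf (f i) atTop) = 0 → (⨆ i, liminf (g i) atTop) = 0) ∧
    (limsup (fun n => ⨆ i, f i n) atTop = 0 → limsup (fun n => ⨆ i, g i n) atTop = 0) ∧
    (liminf (fun n => ⨆ i, f i n) atTop = 0 → liminf (fun n => ⨆ i, g i n) atTop = 0) := by
  refine ⟨?_, ?_, ?_⟩
  · rw [sup_zero (fun i => (limsup_nonneg' (hf0 i) (hfb i)).1)
        (fun i => (limsup_nonneg' (hf0 i) (hfb i)).2.2.1),
      sup_zero (fun i => (limsup_nonneg' (hg0 i) (hgb i)).1)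
        (fun i => (limsup_nonneg' (hg0 i) (hgb i)).2.2.1)]
    intro hz i
    obtain ⟨k, hk⟩ := h i
    exact (lims_zero hC he (hf0 k) (hfb k) (hg0 i) (hgb i) hk).1 (hz k)
  · rw [sup_zero (fun i => (limsup_nonneg' (hf0 i) (hfb i)).2.1)
        (fun i => (limsup_nonneg' (hf0 i) (hfb i)).2.2.2),
      sup_zero (fun i => (limsup_nonneg' (hg0 i) (hgb i)).2.1)
        (fun i => (limsup_nonneg' (hg0 i) (hgb i)).2.2.2)]
    intro hz i
    obtain ⟨k, hk⟩ := h i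
    exact (lims_zero hC he (hf0 k) (hfb k) (hg0 i) (hgb i) hk).2 (hz k)
  · refine lims_zero hC he (b := b) (fun n => Real.iSup_nonneg fun i => hf0 i n)
      (fun n => Real.iSup_le (fun i => hfb i n) hb) (fun n => Real.iSup_nonneg fun i => hg0 i n)
      (fun n => Real.iSup_le (fun i => hgb i n) hb) ?_
    intro n
    have hn : 0 ≤ ⨆ i, f i n := Real.iSup_nonneg fun i => hf0 i n
    refine Real.iSup_le (fun i => ?_) (add_nonneg (mul_nonneg hC hn) (he0 n))
    obtain ⟨k, hk⟩ := h i
    refine (hk n).trans ?_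
    gcongr
    exact le_ciSup (f := fun i => f i n) ⟨b, by rintro _ ⟨j, rfl⟩; exact hfb j n⟩ k

section
open scoped Matrix.Norms.L2Operator

theorem sNorm_eq {d : ℕ} (S : Matrix (Fin d) (Fin d) ℝ) : sNorm S = ‖S‖ := rfl

theorem bounds {d : ℕ} (Q : ℕ → Matrix (Fin d) (Fin d) ℝ)
    (Qlim : Matrix (Fin d) (Fin d) ℝ) (hQunit : IsUnit Qlim)
    (hQlim : Filter.Tendsto (fun n => sNorm (Q n - Qlim)) atTop (nhds 0)) :
    ∃ M : ℝ, (∀ n, sNorm (Q n) ≤ M) ∧ (∀ n, sNorm (Q n)⁻¹ ≤ M) ∧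
      Tendsto (fun n => sNorm (Q n - Q (n + 1))) atTop (nhds 0) ∧
      Tendsto (fun n => sNorm ((Q n)⁻¹ - (Q (n + 1))⁻¹)) atTop (nhds 0) := by
  simp only [sNorm_eq] at *
  have h1 : Tendsto Q atTop (nhds Qlim) := tendsto_iff_norm_sub_tendsto_zero.2 hQlim
  have h2 : Tendsto (fun n => (Q n)⁻¹) atTop (nhds Qlim⁻¹) := by
    obtain ⟨u, rfl⟩ := hQunit
    simp only [Matrix.nonsing_inv_eq_ringInverse]
    exact (NormedRing.inverse_continuousAt u).tendsto.comp h1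
  obtain ⟨M1, hM1⟩ := h1.norm.bddAbove_range
  obtain ⟨M2, hM2⟩ := h2.norm.bddAbove_range
  refine ⟨max M1 M2, fun n => (hM1 ⟨n, rfl⟩).trans (le_max_left _ _),
    fun n => (hM2 ⟨n, rfl⟩).trans (le_max_right _ _), ?_, ?_⟩
  · simpa using (h1.sub (h1.comp (tendsto_add_atTop_nat 1))).norm
  · simpa using (h2.sub (h2.comp (tendsto_add_atTop_nat 1))).norm

end



/-- If the invertible matrices `Q_n` converge to an invertible matrix `Q`, then each
of the four angular values of `u_{n+1} = A_n u_n` vanishes iff the corresponding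
angular value of the transformed system `Ã_n = Q_{n+1} A_n Q_n⁻¹` vanishes. -/
theorem stmt12 (d s : ℕ) (hs : 1 ≤ s) (hsd : s ≤ d)
    (A : ℕ → Matrix (Fin d) (Fin d) ℝ)
    (hinv : ∀ n, IsUnit (A n))
    (hbd : ∃ C : ℝ, ∀ n, sNorm (A n) ≤ C ∧ sNorm (A n)⁻¹ ≤ C)
    (Q : ℕ → Matrix (Fin d) (Fin d) ℝ) (hQinv : ∀ n, IsUnit (Q n))
    (Qlim : Matrix (Fin d) (Fin d) ℝ) (hQunit : IsUnit Qlim)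
    (hQlim : Filter.Tendsto (fun n => sNorm (Q n - Qlim)) atTop (nhds 0))
    (At : ℕ → Matrix (Fin d) (Fin d) ℝ)
    (hAt : ∀ n, At n = Q (n + 1) * A n * (Q n)⁻¹) :
    (thSupLimsup s A = 0 ↔ thSupLimsup s At = 0) ∧
    (thSupLiminf s A = 0 ↔ thSupLiminf s At = 0) ∧
    (thLimsupSup s A = 0 ↔ thLimsupSup s At = 0) ∧
    (thLiminfSup s A = 0 ↔ thLiminfSup s At = 0) := by
  obtain ⟨M, hM, hMi, hl, hli⟩ := bounds Q Qlim hQunit hQlim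
  have hd : ∀ n, IsUnit (Q n).det := fun n => (Matrix.isUnit_iff_isUnit_det _).1 (hQinv n)
  have hQi : ∀ n, IsUnit (Q n)⁻¹ := fun n => Matrix.isUnit_nonsing_inv_iff.2 (hQinv n)
  have hAtu : ∀ n, IsUnit (At n) := fun n => by
    rw [hAt]
    exact ((hQinv _).mul (hinv n)).mul (hQi n)
  have hA : ∀ n, A n = (Q (n + 1))⁻¹ * At n * ((Q n)⁻¹)⁻¹ := fun n => by
    rw [hAt, Matrix.nonsing_inv_nonsing_inv _ (hd n)]
    simp only [Matrix.mul_assoc]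
    rw [Matrix.nonsing_inv_mul_cancel_left _ _ (hd _), Matrix.nonsing_inv_mul _ (hd n),
      Matrix.mul_one]
  obtain ⟨C, e, hC, he0, he, h⟩ := compare hs hinv hQinv hM hMi hl hAt
  obtain ⟨C', e', hC', he0', he', h'⟩ := compare (P := fun n => (Q n)⁻¹) hs hAtu hQi hMi
    (fun n => by rw [Matrix.nonsing_inv_nonsing_inv _ (hd n)]; exact hM n) hli hA
  have a := four (f := fun (V : {V : Submodule ℝ (EuclideanSpace ℝ (Fin d)) // finrank ℝ V = s}) (n : ℕ) =>
    aDisc A V.1 n / n)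
    (g := fun (V : {V : Submodule ℝ (EuclideanSpace ℝ (Fin d)) // finrank ℝ V = s}) (n : ℕ) =>
    aDisc At V.1 n / n) hC Real.pi_pos.le he0 he (fun V n => aDisc_nonneg A V.1 n)
    (fun V n => aDisc_le A V.1 n) (fun V n => aDisc_nonneg At V.1 n)
    (fun V n => aDisc_le At V.1 n) h
  have b := four (f := fun (V : {V : Submodule ℝ (EuclideanSpace ℝ (Fin d)) // finrank ℝ V = s}) (n : ℕ) =>
    aDisc At V.1 n / n)
    (g := fun (V : {V : Submodule ℝ (EuclideanSpace ℝ (Fin d)) // finrank ℝ V = s}) (n : ℕ) =>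
    aDisc A V.1 n / n) hC' Real.pi_pos.le he0' he' (fun V n => aDisc_nonneg At V.1 n)
    (fun V n => aDisc_le At V.1 n) (fun V n => aDisc_nonneg A V.1 n)
    (fun V n => aDisc_le A V.1 n) h'
  exact ⟨⟨a.1, b.1⟩, ⟨a.2.1, b.2.1⟩, ⟨a.2.2.1, b.2.2.1⟩, ⟨a.2.2.2, b.2.2.2⟩⟩
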